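/- Let a, c ≥ 2 and b ≥ 1 be integers, and let j, k be integers with 1 ≤ j ≤ a−1 and 1 ≤ k ≤ c−1. Denote by ADJ(a,b,c)_{j,k} the number of lozenge tilings of the hexagon H_{a,b,c} with two dents of opposite orientation removed in position j along a side of length a and position k along the adjacent side of length c, positions counted from the common vertex of the two sides. Then ADJ(a,b,c)_{j,k} · ADJ(a−1,b,c−1)_{j,k} = ADJ(a,b,c−1)_{j,k} · ADJ(a−1,b,c)_{j,k} + ADJ(a−1,b+1,c−1)_{j,k} · ADJ(a,b−1,c)_{j,k}. -/

import Mathlib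

/-- A unit triangle of the triangular lattice, encoded as `(x, y, ε)` where
`ε = true` means up-pointing and `ε = false` means down-pointing. -/
abbrev Tri : Type := ℤ × ℤ × Bool

/-- Two unit triangles are adjacent (i.e. together they form a lozenge) iff one of them is
the up-triangle at `(x,y)` and the other is one of the down-triangles at
`(x,y)`, `(x-1,y)`, `(x,y-1)`. -/
def Adj (s t : Tri) : Prop :=
  ∃ x y : ℤ,
    ({s, t} : Set Tri) = {(x, y, true), (x, y, false)} ∨
    ({s, t} : Set Tri) = {(x, y, true), (x - 1, y, false)} ∨
    ({s, t} : Set Tri) = {(x, y, true), (x, y - 1, false)}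

/-- `P` is a lozenge tiling of the region `R`: a partition of `R` into pairs of
adjacent unit triangles. -/
def IsLozengeTiling (R : Set Tri) (P : Set (Set Tri)) : Prop :=
  (∀ L ∈ P, ∃ s t : Tri, Adj s t ∧ L = {s, t}) ∧
  (∀ L ∈ P, L ⊆ R) ∧
  (∀ r ∈ R, ∃! L, L ∈ P ∧ r ∈ L)

/-- The number of lozenge tilings of the region `R`. -/
noncomputable def M (R : Set Tri) : ℕ :=
  Nat.card {P : Set (Set Tri) // IsLozengeTiling R P}

/-- The hexagonal region `H^k_{a,b,c}` on the triangular lattice, whose side lengths in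
clockwise order starting from the top side are `a, b+k, c, a+k, b, c+k`.
(Concretely: the unit triangles all of whose vertices `(x,y)` satisfy
`0 ≤ x ≤ a+b+k`, `0 ≤ y ≤ b+c+k`, `b ≤ x+y ≤ a+b+c+k`.) -/
def HexK (a b c k : ℕ) : Set Tri :=
  {t | 0 ≤ t.1 ∧ t.1 ≤ (a : ℤ) + b + k - 1 ∧ 0 ≤ t.2.1 ∧ t.2.1 ≤ (b : ℤ) + c + k - 1 ∧
    (if t.2.2 then (b : ℤ) ≤ t.1 + t.2.1 ∧ t.1 + t.2.1 ≤ (a : ℤ) + b + c + k - 1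
     else (b : ℤ) - 1 ≤ t.1 + t.2.1 ∧ t.1 + t.2.1 ≤ (a : ℤ) + b + c + k - 2)}

/-- The hexagonal region `H_{a,b,c}` whose side lengths in clockwise order starting from
the top side are `a, b, c, a, b, c`. -/
def Hex (a b c : ℕ) : Set Tri := HexK a b c 0

/-- `ADJ(a,b,c)_{j,k}`: the number of lozenge tilings of the hexagon `H_{a,b,c}` with two
dents of opposite orientation removed in position `j` along a side of length `a` and
position `k` along the adjacent side of length `c`, positions counted from the common
vertex of the two sides: the up-pointing triangle `(a+b-j, 0)` on the southern side and
the down-pointing triangle `(a+b-1, k-1)` on the adjacent southeastern side. -/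
noncomputable def ADJ (a b c j k : ℕ) : ℕ :=
  M (Hex a b c \ {((a : ℤ) + b - j, 0, true), ((a : ℤ) + b - 1, (k : ℤ) - 1, false)})

theorem adj_symm {s t : Tri} (h : Adj s t) : Adj t s := by
  obtain ⟨x, y, h⟩ := h
  exact ⟨x, y, by rwa [Set.pair_comm t s]⟩

theorem adj_down_iff {x y : ℤ} {t : Tri} :
    Adj (x, y, false) t ↔ t = (x, y, true) ∨ t = (x + 1, y, true) ∨ t = (x, y + 1, true) := by
  constructor
  · rintro ⟨x', y', h⟩
    simp only [Set.pair_eq_pair_iff, Prod.mk.injEq, Bool.false_eq_true, and_false, false_and,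
      false_or, and_true] at h
    rcases h with ⟨⟨rfl, rfl⟩, rfl⟩ | ⟨⟨rfl, rfl⟩, rfl⟩ | ⟨⟨rfl, rfl⟩, rfl⟩ <;> simp
  · rintro (rfl | rfl | rfl)
    · exact ⟨x, y, Or.inl (Set.pair_comm _ _)⟩
    · exact ⟨x + 1, y, Or.inr (Or.inl (by rw [Set.pair_comm]; simp))⟩
    · exact ⟨x, y + 1, Or.inr (Or.inr (by rw [Set.pair_comm]; simp))⟩

theorem adj_up_iff {x y : ℤ} {t : Tri} :
    Adj (x, y, true) t ↔ t = (x, y, false) ∨ t = (x - 1, y, false) ∨ t = (x, y - 1, false) := by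
  constructor
  · rintro ⟨x', y', h⟩
    simp only [Set.pair_eq_pair_iff, Prod.mk.injEq, Bool.true_eq_false, and_false, false_and,
      or_false, and_true] at h
    rcases h with ⟨⟨rfl, rfl⟩, rfl⟩ | ⟨⟨rfl, rfl⟩, rfl⟩ | ⟨⟨rfl, rfl⟩, rfl⟩ <;> simp
  · rintro (rfl | rfl | rfl)
    · exact ⟨x, y, Or.inl rfl⟩
    · exact ⟨x, y, Or.inr (Or.inl rfl)⟩
    · exact ⟨x, y, Or.inr (Or.inr rfl)⟩

theorem Adj.ne {s t : Tri} (h : Adj s t) : s ≠ t := by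
  rintro rfl
  obtain ⟨x, y, ε⟩ := s
  cases ε
  · simp [adj_down_iff] at h
  · simp [adj_up_iff] at h

theorem IsLozengeTiling.eq_of_mem {R : Set Tri} {P : Set (Set Tri)} (h : IsLozengeTiling R P)
    {L L' : Set Tri} (hL : L ∈ P) (hL' : L' ∈ P) {r : Tri} (hr : r ∈ L) (hr' : r ∈ L') :
    L = L' :=
  (h.2.2 r (h.2.1 L hL hr)).unique ⟨hL, hr⟩ ⟨hL', hr'⟩

theorem IsLozengeTiling.insert {R : Set Tri} {Q : Set (Set Tri)} {u v : Tri} (huv : Adj u v)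
    (hu : u ∈ R) (hv : v ∈ R) (h : IsLozengeTiling (R \ {u, v}) Q) :
    IsLozengeTiling R (insert {u, v} Q) := by
  have hsub : ({u, v} : Set Tri) ⊆ R := by
    rintro t (rfl | rfl) <;> assumption
  refine ⟨?_, ?_, ?_⟩
  · rintro L (rfl | hL)
    · exact ⟨u, v, huv, rfl⟩
    · exact h.1 L hL
  · rintro L (rfl | hL)
    · exact hsub
    · exact (h.2.1 L hL).trans Set.sdiff_subset
  · intro r hr
    by_cases hruv : r ∈ ({u, v} : Set Tri)
    · refine ⟨{u, v}, ⟨Set.mem_insert _ _, hruv⟩, ?_⟩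
      rintro L ⟨rfl | hL, hrL⟩
      · rfl
      · exact absurd hruv (h.2.1 L hL hrL).2
    · obtain ⟨L, ⟨hL, hrL⟩, huniq⟩ := h.2.2 r ⟨hr, hruv⟩
      refine ⟨L, ⟨Set.mem_insert_of_mem _ hL, hrL⟩, ?_⟩
      rintro L' ⟨rfl | hL', hrL'⟩
      · exact absurd hrL' hruv
      · exact huniq L' ⟨hL', hrL'⟩

theorem IsLozengeTiling.erase {R : Set Tri} {P : Set (Set Tri)} {u v : Tri}
    (h : IsLozengeTiling R P) (huv : {u, v} ∈ P) :
    IsLozengeTiling (R \ {u, v}) (P \ {{u, v}}) := by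
  refine ⟨fun L hL => h.1 L hL.1, fun L hL t ht => ⟨h.2.1 L hL.1 ht, fun ht' => ?_⟩, ?_⟩
  · exact hL.2 (h.eq_of_mem hL.1 huv ht ht')
  · rintro r ⟨hr, hruv⟩
    obtain ⟨L, ⟨hL, hrL⟩, huniq⟩ := h.2.2 r hr
    refine ⟨L, ⟨⟨hL, fun hLuv => hruv (hLuv ▸ hrL)⟩, hrL⟩, ?_⟩
    rintro L' ⟨hL', hrL'⟩
    exact huniq L' ⟨hL'.1, hrL'⟩

theorem finite_tilings {R : Set Tri} (hR : R.Finite) : {P | IsLozengeTiling R P}.Finite :=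
  hR.finite_subsets.finite_subsets.subset fun _ hP L hL => hP.2.1 L hL

theorem M_eq_ncard (R : Set Tri) : M R = {P | IsLozengeTiling R P}.ncard := rfl

theorem ncard_tilings_mem {R : Set Tri} {u v : Tri} (huv : Adj u v)
    (hu : u ∈ R) (hv : v ∈ R) :
    {P | IsLozengeTiling R P ∧ {u, v} ∈ P}.ncard = M (R \ {u, v}) := by
  rw [M_eq_ncard]
  refine Set.ncard_congr (fun P _ => P \ {{u, v}}) ?_ ?_ ?_
  · rintro P ⟨hP, hmem⟩
    exact hP.erase hmem
  · rintro P Q ⟨-, hP⟩ ⟨-, hQ⟩ h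
    rw [← Set.insert_sdiff_self_of_mem hP, ← Set.insert_sdiff_self_of_mem hQ, h]
  · intro Q hQ
    refine ⟨Insert.insert {u, v} Q, ⟨hQ.insert huv hu hv, Set.mem_insert _ _⟩, ?_⟩
    refine Set.insert_sdiff_self_of_notMem fun hmem => ?_
    exact (hQ.2.1 _ hmem (Set.mem_insert u _)).2 (Set.mem_insert u _)

open Classical in
/-- Counting tilings according to the partner of a given unit triangle. -/
theorem M_eq_sum {R : Set Tri} (hR : R.Finite) {u : Tri} (hu : u ∈ R) (s : Finset Tri)
    (hs : ∀ v ∈ s, Adj u v) (hs' : ∀ v ∈ R, Adj u v → v ∈ s) :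
    M R = ∑ v ∈ s, if v ∈ R then M (R \ {u, v}) else 0 := by
  have hfin := finite_tilings hR
  have hunion : hfin.toFinset =
      s.biUnion fun v => hfin.toFinset.filter fun P => {u, v} ∈ P := by
    ext P
    simp only [Set.Finite.mem_toFinset, Set.mem_ofPred_eq, Finset.mem_biUnion, Finset.mem_filter]
    refine ⟨fun hP => ?_, fun ⟨_, _, hP, _⟩ => hP⟩
    obtain ⟨L, ⟨hL, huL⟩, -⟩ := hP.2.2 u hu
    obtain ⟨p, q, hpq, rfl⟩ := hP.1 L hL
    have hsub := hP.2.1 _ hL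
    rcases huL with rfl | rfl
    · exact ⟨q, hs' q (hsub (by simp)) hpq, hP, hL⟩
    · exact ⟨p, hs' p (hsub (by simp)) (adj_symm hpq), hP, by rwa [Set.pair_comm]⟩
  rw [M_eq_ncard, Set.ncard_eq_toFinset_card _ hfin, hunion, Finset.card_biUnion]
  · refine Finset.sum_congr rfl fun v hv => ?_
    split_ifs with hvR
    · rw [← ncard_tilings_mem (hs v hv) hu hvR, Set.ncard_eq_toFinset_card _
        (hfin.subset fun _ hP => hP.1)]
      congr 1
      ext P
      simp
    · rw [Finset.card_eq_zero, Finset.filter_eq_empty_iff]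
      intro P hP hmem
      rw [Set.Finite.mem_toFinset] at hP
      exact hvR (hP.2.1 _ hmem (by simp))
  · intro v hv w hw hvw
    rw [Function.onFun, Finset.disjoint_left]
    intro P hP hP'
    simp only [Set.Finite.mem_toFinset, Set.mem_ofPred_eq, Finset.mem_filter] at hP hP'
    have h := hP.1.eq_of_mem (r := u) hP.2 hP'.2 (by simp) (by simp)
    rw [Set.pair_eq_pair_iff] at h
    rcases h with h | h
    · exact hvw h.2
    · exact hvw (h.2.trans h.1)

theorem M_empty : M ∅ = 1 := by
  rw [M_eq_ncard, Set.ncard_eq_one]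
  refine ⟨∅, Set.eq_singleton_iff_unique_mem.2 ⟨⟨by simp, by simp, by simp⟩, fun P hP => ?_⟩⟩
  rw [Set.eq_empty_iff_forall_notMem]
  intro L hL
  obtain ⟨s, t, -, rfl⟩ := hP.1 L hL
  exact hP.2.1 _ hL (Set.mem_insert s _)

/-- The up-triangle lying below the edge at height `y` of the antidiagonal `d`. -/
abbrev upTri (d y : ℤ) : Tri := (d - 1 - y, y, true)

/-- The down-triangle lying above the edge at height `y` of the antidiagonal `d`. -/
abbrev downTri (d y : ℤ) : Tri := (d - 1 - y, y, false)

/-- The part of a region above the antidiagonal `d`, where the region has an up-triangle below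
the edge `(e, y)` iff `U e y` and a down-triangle above it iff `D e y`. In the first strip, the
down-triangles are those at the heights in `Y`, and the up-triangles at the heights in `Z` are
removed. -/
def stage (U D : ℤ → ℤ → Prop) (d : ℤ) (Y Z : Set ℤ) : Set Tri :=
  {t | if t.2.2 then d + 1 ≤ t.1 + t.2.1 + 1 ∧ U (t.1 + t.2.1 + 1) t.2.1 ∧
          (t.1 + t.2.1 + 1 = d + 1 → t.2.1 ∉ Z)
        else (t.1 + t.2.1 + 1 = d ∧ t.2.1 ∈ Y) ∨
          (d + 1 ≤ t.1 + t.2.1 + 1 ∧ D (t.1 + t.2.1 + 1) t.2.1)}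

section Stage

variable {U D : ℤ → ℤ → Prop} {d : ℤ} {Y Z : Set ℤ}

theorem upTri_mem_stage {e y : ℤ} :
    upTri e y ∈ stage U D d Y Z ↔ d + 1 ≤ e ∧ U e y ∧ (e = d + 1 → y ∉ Z) := by
  have h : e - 1 - y + y + 1 = e := by ring
  simp only [stage, Set.mem_ofPred_eq, h, if_true]

theorem downTri_mem_stage {e y : ℤ} :
    downTri e y ∈ stage U D d Y Z ↔ (e = d ∧ y ∈ Y) ∨ (d + 1 ≤ e ∧ D e y) := by
  have h : e - 1 - y + y + 1 = e := by ring
  simp only [stage, Set.mem_ofPred_eq, h, Bool.false_eq_true, if_false]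

theorem tri_cases (t : Tri) : (∃ e y, t = upTri e y) ∨ ∃ e y, t = downTri e y := by
  obtain ⟨x, y, _ | _⟩ := t
  · exact Or.inr ⟨x + y + 1, y, by simp [downTri]⟩
  · exact Or.inl ⟨x + y + 1, y, by simp [upTri]⟩

theorem upTri_inj {e y e' y' : ℤ} : upTri e y = upTri e' y' ↔ e = e' ∧ y = y' := by
  simp only [Prod.mk.injEq, and_true]; omega

theorem downTri_inj {e y e' y' : ℤ} : downTri e y = downTri e' y' ↔ e = e' ∧ y = y' := by
  simp only [Prod.mk.injEq, and_true]; omega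

theorem adj_downTri_iff {e y : ℤ} {t : Tri} :
    Adj (downTri e y) t ↔ t = upTri e y ∨ t = upTri (e + 1) y ∨ t = upTri (e + 1) (y + 1) := by
  have h₁ : upTri (e + 1) y = (e - 1 - y + 1, y, true) := Prod.ext (by dsimp only; ring) rfl
  have h₂ : upTri (e + 1) (y + 1) = (e - 1 - y, y + 1, true) :=
    Prod.ext (by dsimp only; ring) rfl
  rw [adj_down_iff, h₁, h₂]

theorem adj_upTri_iff {e y : ℤ} {t : Tri} :
    Adj (upTri e y) t ↔
      t = downTri e y ∨ t = downTri (e - 1) y ∨ t = downTri (e - 1) (y - 1) := by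
  have h₁ : downTri (e - 1) y = (e - 1 - y - 1, y, false) := Prod.ext (by dsimp only; ring) rfl
  have h₂ : downTri (e - 1) (y - 1) = (e - 1 - y, y - 1, false) :=
    Prod.ext (by dsimp only; ring) rfl
  rw [adj_up_iff, h₁, h₂]

theorem ext_tri {R S : Set Tri} (hup : ∀ e y, upTri e y ∈ R ↔ upTri e y ∈ S)
    (hdown : ∀ e y, downTri e y ∈ R ↔ downTri e y ∈ S) : R = S := by
  ext t
  obtain ⟨e, y, rfl⟩ | ⟨e, y, rfl⟩ := tri_cases t
  · exact hup e y
  · exact hdown e y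

theorem stage_finite (hU : {p : ℤ × ℤ | U p.1 p.2}.Finite) (hD : {p : ℤ × ℤ | D p.1 p.2}.Finite)
    (hY : Y.Finite) : (stage U D d Y Z).Finite := by
  refine (((hU.image fun p => upTri p.1 p.2).union (hD.image fun p => downTri p.1 p.2)).union
    (hY.image fun y => downTri d y)).subset fun t ht => ?_
  obtain ⟨e, y, rfl⟩ | ⟨e, y, rfl⟩ := tri_cases t
  · rw [upTri_mem_stage] at ht
    exact Or.inl (Or.inl ⟨(e, y), ht.2.1, rfl⟩)
  · rw [downTri_mem_stage] at ht
    rcases ht with ⟨rfl, hy⟩ | ht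
    · exact Or.inr ⟨y, hy, rfl⟩
    · exact Or.inl (Or.inr ⟨(e, y), ht.2, rfl⟩)

theorem stage_diff_pair {y z : ℤ} (hy : y ∉ Y) :
    stage U D d (insert y Y) Z \ {downTri d y, upTri (d + 1) z} =
      stage U D d Y (insert z Z) := by
  refine ext_tri (fun e w => ?_) fun e w => ?_
  · simp only [Set.mem_sdiff, upTri_mem_stage, Set.mem_insert_iff, Set.mem_singleton_iff,
      upTri_inj]
    simp only [upTri, downTri, Prod.mk.injEq, Bool.true_eq_false, and_false, false_or]
    grind
  · simp only [Set.mem_sdiff, downTri_mem_stage, Set.mem_insert_iff, Set.mem_singleton_iff,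
      downTri_inj]
    simp only [upTri, downTri, Prod.mk.injEq, Bool.false_eq_true, and_false, or_false]
    grind

open Classical in
/-- A down-triangle of the first strip is matched with one of the two up-triangles following
it in its strip. -/
theorem M_stage_insert (hU : {p : ℤ × ℤ | U p.1 p.2}.Finite)
    (hD : {p : ℤ × ℤ | D p.1 p.2}.Finite) (hY : Y.Finite) {y : ℤ} (hy : y ∉ Y) :
    M (stage U D d (insert y Y) Z) =
      (if U (d + 1) y ∧ y ∉ Z then M (stage U D d Y (insert y Z)) else 0) +
      if U (d + 1) (y + 1) ∧ y + 1 ∉ Z then M (stage U D d Y (insert (y + 1) Z)) else 0 := by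
  rw [M_eq_sum (stage_finite hU hD (hY.insert y)) (u := downTri d y)
    (by simp [downTri_mem_stage]) {upTri (d + 1) y, upTri (d + 1) (y + 1)}]
  · rw [Finset.sum_pair (by simp), stage_diff_pair hy, stage_diff_pair hy]
    simp [upTri_mem_stage]
  · simp [adj_downTri_iff]
  · intro v hv h
    rcases adj_downTri_iff.1 h with rfl | rfl | rfl
    · rw [upTri_mem_stage] at hv
      omega
    · simp
    · simp

open Classical in
/-- Up-triangles whose neighbours below are missing form lozenges with the triangles above. -/
theorem M_remove_forced {d : ℤ} (S : Finset ℤ) {R : Set Tri} (hR : R.Finite)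
    (hS : ∀ y ∈ S, upTri d y ∈ R) (hdown : ∀ y, downTri (d - 1) y ∉ R) :
    M R = if ∀ y ∈ S, downTri d y ∈ R then
      M (R \ {t | ∃ y ∈ S, t = upTri d y ∨ t = downTri d y}) else 0 := by
  induction S using Finset.induction_on generalizing R with
  | empty => simp
  | insert y S hy ih =>
    have hforced := M_eq_sum hR (hS y (by simp)) {downTri d y} (by simp [adj_upTri_iff]) (by
      intro v hv h
      rcases adj_upTri_iff.1 h with rfl | rfl | rfl
      · simp
      · exact absurd hv (hdown _)
      · exact absurd hv (hdown _))
    rw [hforced, Finset.sum_singleton]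
    by_cases hmem : downTri d y ∈ R
    · rw [if_pos hmem, ih (hR.subset Set.sdiff_subset)]
      · have hiff : (∀ z ∈ S, downTri d z ∈ R \ {upTri d y, downTri d y}) ↔
            ∀ z ∈ insert y S, downTri d z ∈ R := by
          simp only [Finset.forall_mem_insert, hmem, true_and]
          refine forall₂_congr fun z hz => ?_
          have : z ≠ y := fun h => hy (h ▸ hz)
          simp [this]
        simp only [hiff]
        congr 2
        ext t
        simp only [Set.mem_sdiff, Set.mem_insert_iff, Set.mem_singleton_iff, Set.mem_ofPred_eq,
          Finset.exists_mem_insert]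
        simp only [not_or, and_assoc]
      · intro z hz
        have : z ≠ y := fun h => hy (h ▸ hz)
        exact ⟨hS z (by simp [hz]), by simp [this]⟩
      · exact fun z hz => hdown z hz.1
    · rw [if_neg hmem, if_neg fun h => hmem (h y (by simp))]

open Classical in
/-- When all down-triangles of the first strip are used up, its remaining up-triangles are
matched with down-triangles of the second strip. -/
theorem M_stage_next (hU : {p : ℤ × ℤ | U p.1 p.2}.Finite)
    (hD : {p : ℤ × ℤ | D p.1 p.2}.Finite) (Z : Set ℤ) :
    M (stage U D d ∅ Z) =
      if ∀ y, U (d + 1) y → y ∉ Z → D (d + 1) y then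
        M (stage U D (d + 1) {y | D (d + 1) y ∧ (U (d + 1) y → y ∈ Z)} ∅) else 0 := by
  have hfin : {y | U (d + 1) y ∧ y ∉ Z}.Finite := by
    refine (hU.image Prod.snd).subset fun y hy => ⟨(d + 1, y), hy.1, rfl⟩
  rw [M_remove_forced (d := d + 1) hfin.toFinset (stage_finite hU hD Set.finite_empty)]
  · congr 1
    · simp [downTri_mem_stage]
    · congr 1
      refine ext_tri (fun e w => ?_) fun e w => ?_
      · simp only [Set.mem_sdiff, upTri_mem_stage, Set.mem_ofPred_eq, Set.Finite.mem_toFinset,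
          upTri_inj, Set.mem_empty_iff_false, not_false_eq_true, imp_true_iff, and_true]
        simp only [upTri, downTri, Prod.mk.injEq, Bool.true_eq_false, and_false, or_false]
        grind
      · simp only [Set.mem_sdiff, downTri_mem_stage, Set.mem_ofPred_eq, Set.Finite.mem_toFinset,
          downTri_inj, Set.mem_empty_iff_false, and_false, false_or]
        simp only [upTri, downTri, Prod.mk.injEq, Bool.false_eq_true, and_false, false_or]
        grind
  · simp only [Set.Finite.mem_toFinset, Set.mem_ofPred_eq, upTri_mem_stage]
    exact fun y hy => ⟨le_rfl, hy.1, fun _ => hy.2⟩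
  · intro y
    simp [downTri_mem_stage]

end Stage

section Transfer

variable {U D : ℤ → ℤ → Prop} {d lo hi : ℤ} {n : ℕ} {V : Type*} [AddCommGroup V]

theorem M_stage_partial (hU : {p : ℤ × ℤ | U p.1 p.2}.Finite)
    (hD : {p : ℤ × ℤ | D p.1 p.2}.Finite) (alt : V [⋀^Fin n]→ₗ[ℤ] ℤ) {F G : ℤ → V}
    (hFG : ∀ y, F y = G y + G (y + 1))
    (hout : ∀ u, lo ≤ u → u ≤ hi + 1 → ¬ U (d + 1) u → ∀ v i, v i = G u → alt v = 0)
    (hin : ∀ z : Fin n → ℤ, StrictMono z → (∀ i, lo ≤ z i) → (∀ i, z i ≤ hi + 1) →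
      (∀ i, U (d + 1) (z i)) → (M (stage U D d ∅ (Set.range z)) : ℤ) = alt fun i => G (z i))
    (r m : ℕ) (hm : m + r = n) (w : Fin n → ℤ)
    (hw : ∀ i j, i < j → w i ≤ w j ∧ (w i = w j → i.val < m ∧ m ≤ j.val))
    (hlo : ∀ i, lo ≤ w i) (hhi : ∀ i, w i ≤ hi + 1) (hhi' : ∀ i : Fin n, m ≤ i.val → w i ≤ hi)
    (hUw : ∀ i : Fin n, i.val < m → U (d + 1) (w i)) :
    (M (stage U D d (w '' {i | m ≤ i.val}) (w '' {i | i.val < m})) : ℤ) =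
      alt fun i => if i.val < m then G (w i) else F (w i) := by
  classical
  induction r generalizing m w with
  | zero =>
    obtain rfl : m = n := by omega
    have h₁ : {i : Fin m | m ≤ i.val} = ∅ := by
      ext i; simp
    have h₂ : {i : Fin m | i.val < m} = Set.univ := by
      ext i; simp
    rw [h₁, h₂, Set.image_empty, Set.image_univ, hin w _ hlo hhi fun i => hUw i i.2]
    · simp
    · intro i j hij
      refine lt_of_le_of_ne (hw i j hij).1 fun h => ?_
      have := ((hw i j hij).2 h).2
      omega
  | succ r ih =>
    obtain ⟨i₀, hi₀⟩ : ∃ i₀ : Fin n, i₀.val = m := ⟨⟨m, by omega⟩, rfl⟩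
    have hY : {i : Fin n | m ≤ i.val} = insert i₀ {i : Fin n | m + 1 ≤ i.val} := by
      ext i
      simp only [Set.mem_ofPred_eq, Set.mem_insert_iff, Fin.ext_iff]
      omega
    have hZ : {i : Fin n | i.val < m + 1} = insert i₀ {i : Fin n | i.val < m} := by
      ext i
      simp only [Set.mem_ofPred_eq, Set.mem_insert_iff, Fin.ext_iff]
      omega
    have hnot : w i₀ ∉ w '' {i : Fin n | m + 1 ≤ i.val} := by
      rintro ⟨j, hj, h⟩
      have hj' : m + 1 ≤ j.val := hj
      have := ((hw i₀ j (by rw [Fin.lt_def]; omega)).2 h.symm).1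
      omega
    set v : Fin n → V := fun i => if i.val < m then G (w i) else F (w i) with hv
    have key : ∀ u, u = w i₀ ∨ u = w i₀ + 1 →
        ((if U (d + 1) u ∧ u ∉ w '' {i : Fin n | i.val < m} then
          M (stage U D d (w '' {i : Fin n | m + 1 ≤ i.val})
            (insert u (w '' {i : Fin n | i.val < m}))) else 0 : ℕ) : ℤ) =
          alt (Function.update v i₀ (G u)) := by
      intro u hu
      have hu₀ := hlo i₀
      have hu₁ := hhi' i₀ hi₀.ge
      by_cases hUu : U (d + 1) u
      swap
      · rw [if_neg fun h => hUu h.1]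
        exact (hout u (by omega) (by omega) hUu _ i₀ (by simp)).symm
      by_cases hmem : u ∈ w '' {i : Fin n | i.val < m}
      · rw [if_neg fun h => h.2 hmem]
        obtain ⟨j, hj, rfl⟩ := hmem
        have hj : j.val < m := hj
        have hne : j ≠ i₀ := by rintro rfl; omega
        symm
        refine alt.map_eq_zero_of_eq _ (i := j) (j := i₀) ?_ hne
        simp [hne, hv, hj]
      · rw [if_pos ⟨hUu, hmem⟩]
        have hlt : ∀ i : Fin n, i.val < m → w i < u := by
          intro i hi
          have h₁ := (hw i i₀ (by rw [Fin.lt_def]; omega)).1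
          have h₂ : w i ≠ u := fun h => hmem ⟨i, hi, h⟩
          omega
        have hgt : ∀ i : Fin n, m < i.val → u ≤ w i := by
          intro i hi
          have hlt : i₀ < i := by rw [Fin.lt_def]; omega
          have h₁ := (hw i₀ i hlt).1
          have h₂ : w i₀ ≠ w i := fun h => by
            have := ((hw i₀ i hlt).2 h).1
            omega
          omega
        have hwi : ∀ i : Fin n, i ≠ i₀ → Function.update w i₀ u i = w i := fun i hi => by simp [hi]
        have hne : ∀ i : Fin n, i.val ≠ m → i ≠ i₀ := fun i hi h => hi (h ▸ hi₀)
        have h := ih (m + 1) (by omega) (Function.update w i₀ u) ?_ ?_ ?_ ?_ ?_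
        · have h₁ : Function.update w i₀ u '' {i : Fin n | m + 1 ≤ i.val} =
              w '' {i : Fin n | m + 1 ≤ i.val} := by
            refine Set.image_congr fun i hi => hwi i (hne i ?_)
            have hi : m + 1 ≤ i.val := hi
            omega
          have h₂ : Function.update w i₀ u '' {i : Fin n | i.val < m} =
              w '' {i : Fin n | i.val < m} := by
            refine Set.image_congr fun i hi => hwi i (hne i ?_)
            have hi : i.val < m := hi
            omega
          rw [hZ, Set.image_insert_eq, h₁, h₂, Function.update_self] at h
          rw [h]
          congr 1
          funext i
          by_cases hi : i = i₀
          · subst hi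
            simp [hi₀]
          · have hi' : i.val ≠ m := fun h => hi (Fin.ext (h.trans hi₀.symm))
            rw [hwi i hi, Function.update_of_ne hi, hv]
            simp only
            congr 1
            simp only [eq_iff_iff]
            omega
        · intro i j hij
          rw [Fin.lt_def] at hij
          by_cases hi : i = i₀
          · subst hi
            have hj : j ≠ i := hne j (by omega)
            rw [hwi j hj, Function.update_self]
            exact ⟨hgt j (by omega), fun _ => by omega⟩
          · rw [hwi i hi]
            by_cases hj : j = i₀
            · subst hj
              rw [Function.update_self]
              have := hlt i (by omega)
              exact ⟨this.le, fun h => by omega⟩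
            · have hj' : j.val ≠ m := fun h => hj (Fin.ext (h.trans hi₀.symm))
              rw [hwi j hj]
              have := hw i j hij
              exact ⟨this.1, fun h => by have := this.2 h; omega⟩
        · intro i
          by_cases hi : i = i₀
          · subst hi; rw [Function.update_self]; omega
          · rw [hwi i hi]; exact hlo i
        · intro i
          by_cases hi : i = i₀
          · subst hi; rw [Function.update_self]; omega
          · rw [hwi i hi]; exact hhi i
        · intro i hi
          rw [hwi i (hne i (by omega))]
          exact hhi' i (by omega)
        · intro i hi
          by_cases hi' : i = i₀
          · subst hi'; rw [Function.update_self]; exact hUu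
          · rw [hwi i hi']
            refine hUw i ?_
            have : i.val ≠ m := fun h => hi' (Fin.ext (h.trans hi₀.symm))
            omega
    have hvi : v i₀ = G (w i₀) + G (w i₀ + 1) := by simp [hv, hi₀, hFG]
    rw [← Function.update_eq_self i₀ v, hvi, alt.map_update_add, ← key _ (Or.inl rfl),
      ← key _ (Or.inr rfl), hY, Set.image_insert_eq,
      M_stage_insert hU hD (Set.toFinite _) hnot, Nat.cast_add]

/-- Transfer through one strip: if tilings above the next antidiagonal are counted by an
alternating form in the vectors `G z`, then tilings above the current one are counted by the
same form in the vectors `G y + G (y + 1)`. -/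
theorem M_stage_transfer (hU : {p : ℤ × ℤ | U p.1 p.2}.Finite)
    (hD : {p : ℤ × ℤ | D p.1 p.2}.Finite) (alt : V [⋀^Fin n]→ₗ[ℤ] ℤ) {F G : ℤ → V}
    (hFG : ∀ y, F y = G y + G (y + 1))
    (hout : ∀ u, lo ≤ u → u ≤ hi + 1 → ¬ U (d + 1) u → ∀ v i, v i = G u → alt v = 0)
    (hin : ∀ z : Fin n → ℤ, StrictMono z → (∀ i, lo ≤ z i) → (∀ i, z i ≤ hi + 1) →
      (∀ i, U (d + 1) (z i)) → (M (stage U D d ∅ (Set.range z)) : ℤ) = alt fun i => G (z i))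
    (y : Fin n → ℤ) (hy : StrictMono y) (hlo : ∀ i, lo ≤ y i) (hhi : ∀ i, y i ≤ hi) :
    (M (stage U D d (Set.range y) ∅) : ℤ) = alt fun i => F (y i) := by
  have h := M_stage_partial hU hD alt hFG hout hin n 0 (by simp) y
    (fun i j hij => ⟨(hy hij).le, fun h => absurd h (hy hij).ne⟩) hlo
    (fun i => (hhi i).trans (by omega)) (fun i _ => hhi i) (by simp)
  simpa using h

end Transfer

/-- The binomial coefficient with integral arguments, vanishing for a negative lower one. -/
def binom (n m : ℤ) : ℤ := if 0 ≤ m then (n.toNat.choose m.toNat : ℤ) else 0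

theorem binom_add_one {n : ℤ} (hn : 0 ≤ n) (m : ℤ) :
    binom (n + 1) m = binom n m + binom n (m - 1) := by
  lift n to ℕ using hn
  unfold binom
  rcases lt_trichotomy m 0 with hm | rfl | hm
  · rw [if_neg (by omega), if_neg (by omega), if_neg (by omega), add_zero]
  · rw [if_pos le_rfl, if_pos le_rfl, if_neg (by omega)]
    simp
  · obtain ⟨m, rfl⟩ : ∃ l : ℕ, m = l + 1 := ⟨(m - 1).toNat, by omega⟩
    rw [if_pos (by omega), if_pos (by omega), if_pos (by omega), add_sub_cancel_right,
      ← Nat.cast_succ, ← Nat.cast_succ]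
    simp only [Int.toNat_natCast]
    rw [Nat.succ_eq_add_one, Nat.choose_succ_succ']
    push_cast
    ring

theorem binom_of_neg {m : ℤ} (n : ℤ) (hm : m < 0) : binom n m = 0 := if_neg (by omega)

theorem binom_of_lt {n m : ℤ} (hn : 0 ≤ n) (h : n < m) : binom n m = 0 := by
  unfold binom
  rw [if_pos (by omega), Nat.choose_eq_zero_of_lt (by omega), Nat.cast_zero]

theorem binom_zero_left (m : ℤ) : binom 0 m = if m = 0 then 1 else 0 := by
  split_ifs with h
  · subst h; rfl
  · rcases lt_or_gt_of_ne h with h | h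
    · exact binom_of_neg 0 h
    · exact binom_of_lt le_rfl h

theorem StrictMono.add_sub_le {n : ℕ} {z : Fin n → ℤ} (hz : StrictMono z) {i j : Fin n}
    (hij : i ≤ j) : z i + (j.val - i.val) ≤ z j := by
  obtain ⟨i, hi⟩ := i
  obtain ⟨j, hj⟩ := j
  replace hij : i ≤ j := hij
  induction j, hij using Nat.le_induction with
  | base => simp
  | succ j hij ih =>
    have h₁ : z ⟨i, hi⟩ + ((j : ℤ) - i) ≤ z ⟨j, by omega⟩ :=
      ih (by omega)
    have h₂ : z ⟨j, by omega⟩ < z ⟨j + 1, hj⟩ := hz (by simp)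
    change z ⟨i, hi⟩ + (((j + 1 : ℕ) : ℤ) - i) ≤ z ⟨j + 1, hj⟩
    push_cast
    omega

theorem StrictMono.eq_add_of_mem_Ico {n : ℕ} {z : Fin n → ℤ} (hz : StrictMono z) {c : ℤ}
    (hlo : ∀ i, c ≤ z i) (hhi : ∀ i, z i < c + n) (i : Fin n) : z i = c + i := by
  obtain ⟨i, hi⟩ := i
  have h₁ := hz.add_sub_le (i := ⟨0, by omega⟩) (j := ⟨i, hi⟩) (by simp)
  have h₂ := hz.add_sub_le (i := ⟨i, hi⟩) (j := ⟨n - 1, by omega⟩)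
    (by rw [Fin.le_def]; simp only; omega)
  have h₃ := hlo ⟨0, by omega⟩
  have h₄ := hhi ⟨n - 1, by omega⟩
  simp only at h₁ h₂ ⊢
  push_cast [Nat.cast_sub (show 1 ≤ n by omega)] at h₁ h₂
  omega

theorem M_stage_next_of_iff {U D : ℤ → ℤ → Prop} {d : ℤ} {Z : Set ℤ}
    (hU : {p : ℤ × ℤ | U p.1 p.2}.Finite) (hD : {p : ℤ × ℤ | D p.1 p.2}.Finite)
    (h : ∀ y, U (d + 1) y ↔ D (d + 1) y) (hZ : ∀ y ∈ Z, U (d + 1) y) :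
    M (stage U D d ∅ Z) = M (stage U D (d + 1) Z ∅) := by
  rw [M_stage_next hU hD, if_pos fun y hy _ => (h y).1 hy]
  congr 2
  ext y
  have := hZ y
  have := h y
  simp only [Set.mem_ofPred_eq]
  tauto

/-- The up-triangles of the dented hexagon, indexed by their upper edges. -/
def hexUp (a b c j : ℕ) (d y : ℤ) : Prop :=
  0 ≤ d - 1 - y ∧ d - 1 - y ≤ (a : ℤ) + b - 1 ∧ 0 ≤ y ∧ y ≤ (b : ℤ) + c - 1 ∧
    (b : ℤ) + 1 ≤ d ∧ d ≤ (a : ℤ) + b + c ∧ ¬ (d = (a : ℤ) + b - j + 1 ∧ y = 0)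

/-- The down-triangles of the dented hexagon, indexed by their lower edges. -/
def hexDown (a b c k : ℕ) (d y : ℤ) : Prop :=
  0 ≤ d - 1 - y ∧ d - 1 - y ≤ (a : ℤ) + b - 1 ∧ 0 ≤ y ∧ y ≤ (b : ℤ) + c - 1 ∧
    (b : ℤ) ≤ d ∧ d ≤ (a : ℤ) + b + c - 1 ∧ ¬ (d = (a : ℤ) + b + k - 1 ∧ y = k - 1)

/-- The numbers of lattice paths from the edge `(d, y)` to the northeastern side. -/
def pathsToSide (a b c : ℕ) (d y : ℤ) : Fin b → ℤ :=
  fun l => binom (a + b + c - d) (c + l - y)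

/-- The numbers of lattice paths from the edge `(d, y)` to the dent of the southeastern side
and to the northeastern side. -/
def pathsToEnds (a b c k : ℕ) (d y : ℤ) : Fin (b + 1) → ℤ :=
  Matrix.vecCons (binom (a + b + k - 1 - d) (k - 1 - y)) (pathsToSide a b c d y)

section Hexagon

variable {a b c j k : ℕ} {d : ℤ}

theorem finite_hexUp : {p : ℤ × ℤ | hexUp a b c j p.1 p.2}.Finite := by
  refine (((Set.finite_Icc (0 : ℤ) (a + b + c)).prod
    (Set.finite_Icc (0 : ℤ) (b + c)))).subset ?_
  rintro ⟨d, y⟩ h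
  simp only [Set.mem_ofPred_eq, hexUp] at h
  simp only [Set.mem_prod, Set.mem_Icc]
  omega

theorem finite_hexDown : {p : ℤ × ℤ | hexDown a b c k p.1 p.2}.Finite := by
  refine (((Set.finite_Icc (0 : ℤ) (a + b + c)).prod
    (Set.finite_Icc (0 : ℤ) (b + c)))).subset ?_
  rintro ⟨d, y⟩ h
  simp only [Set.mem_ofPred_eq, hexDown] at h
  simp only [Set.mem_prod, Set.mem_Icc]
  omega

theorem pathsToSide_rec (hd : d + 1 ≤ a + b + c) (y : ℤ) :
    pathsToSide a b c d y = pathsToSide a b c (d + 1) y + pathsToSide a b c (d + 1) (y + 1) := by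
  funext l
  simp only [pathsToSide, Pi.add_apply]
  have h₁ : (a + b + c - d : ℤ) = a + b + c - (d + 1) + 1 := by ring
  have h₂ : (c + l - (y + 1) : ℤ) = c + l - y - 1 := by ring
  rw [h₁, h₂, binom_add_one (by omega)]

theorem pathsToEnds_rec (hd : d + 1 ≤ a + b + k - 1) (hk : k ≤ c) (y : ℤ) :
    pathsToEnds a b c k d y =
      pathsToEnds a b c k (d + 1) y + pathsToEnds a b c k (d + 1) (y + 1) := by
  have h₁ : (a + b + k - 1 - d : ℤ) = a + b + k - 1 - (d + 1) + 1 := by ring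
  have h₂ : (k - 1 - (y + 1) : ℤ) = k - 1 - y - 1 := by ring
  simp only [pathsToEnds]
  rw [pathsToSide_rec (by omega), h₁, h₂, binom_add_one (by omega)]
  simp

theorem pathsToSide_eq_zero (hd : d ≤ a + b + c) {y : ℤ}
    (hy : a + b ≤ d - 1 - y ∨ b + c ≤ y) : pathsToSide a b c d y = 0 := by
  funext l
  have := l.2
  rcases hy with hy | hy
  · exact binom_of_lt (by omega) (by omega)
  · exact binom_of_neg _ (by omega)

theorem pathsToEnds_eq_zero (hd : d ≤ a + b + k - 1) (hk : k ≤ c) {y : ℤ}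
    (hy : a + b ≤ d - 1 - y ∨ b + c ≤ y) : pathsToEnds a b c k d y = 0 := by
  have h : binom (a + b + k - 1 - d) (k - 1 - y) = 0 := by
    rcases hy with hy | hy
    · exact binom_of_lt (by omega) (by omega)
    · exact binom_of_neg _ (by omega)
  rw [pathsToEnds, h, pathsToSide_eq_zero (by omega) hy]
  funext l
  refine Fin.cases ?_ ?_ l <;> simp

/-- Above both dents, tilings are counted by the determinant of path numbers. -/
theorem M_stage_above (hj : 1 ≤ j) (hk : 1 ≤ k) (hkc : k ≤ c) (r : ℕ)
    (hd : d + r = a + b + c - 1) (hdk : a + b + k - 1 ≤ d) (y : Fin b → ℤ) (hy : StrictMono y)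
    (hlo : ∀ i, 0 ≤ y i) (hhi : ∀ i, y i ≤ d - 1) :
    (M (stage (hexUp a b c j) (hexDown a b c k) d (Set.range y) ∅) : ℤ) =
      Matrix.detRowAlternating fun i => pathsToSide a b c d (y i) := by
  induction r generalizing d y with
  | zero =>
    refine M_stage_transfer finite_hexUp finite_hexDown _ (pathsToSide_rec (by omega)) ?_ ?_
      y hy hlo hhi
    · intro u hu₀ hu₁ hu v i hvi
      refine AlternatingMap.map_coord_zero _ i (hvi.trans (pathsToSide_eq_zero (by omega) ?_))
      simp only [hexUp] at hu
      omega
    · intro z hz hz₀ hz₁ hzU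
      simp only [hexUp] at hzU
      have hzc := hz.eq_add_of_mem_Ico (c := c) (fun i => by have := hzU i; omega)
        (fun i => by have := hzU i; omega)
      rw [M_stage_next finite_hexUp finite_hexDown, if_pos]
      · have h₁ : {y | hexDown a b c k (d + 1) y ∧
            (hexUp a b c j (d + 1) y → y ∈ Set.range z)} = ∅ := by
          refine Set.eq_empty_iff_forall_notMem.2 fun y hy => ?_
          have := hy.1
          simp only [hexDown] at this
          omega
        have h₂ : stage (hexUp a b c j) (hexDown a b c k) (d + 1) ∅ ∅ = ∅ := by
          refine ext_tri (fun e w => iff_of_false (fun h => ?_) (Set.notMem_empty _))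
            fun e w => iff_of_false (fun h => ?_) (Set.notMem_empty _)
          · simp only [upTri_mem_stage, hexUp, Set.mem_empty_iff_false] at h
            omega
          · simp only [downTri_mem_stage, hexDown, Set.mem_empty_iff_false, and_false,
              false_or] at h
            omega
        have h₃ : (fun i => pathsToSide a b c (d + 1) (z i)) = (1 : Matrix (Fin b) (Fin b) ℤ) := by
          funext i l
          have h₄ : (a + b + c - (d + 1) : ℤ) = 0 := by omega
          rw [pathsToSide, hzc, h₄, binom_zero_left, Matrix.one_apply]
          congr 1
          rw [Fin.ext_iff, eq_iff_iff]
          omega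
        rw [h₁, h₂, M_empty, h₃]
        exact Matrix.det_one.symm
      · intro y hyU hyZ
        simp only [hexUp] at hyU
        refine absurd ⟨⟨(y - c).toNat, by omega⟩, ?_⟩ hyZ
        rw [hzc]
        simp only
        omega
  | succ r ih =>
    refine M_stage_transfer finite_hexUp finite_hexDown _ (pathsToSide_rec (by omega)) ?_ ?_
      y hy hlo hhi
    · intro u hu₀ hu₁ hu v i hvi
      refine AlternatingMap.map_coord_zero _ i (hvi.trans (pathsToSide_eq_zero (by omega) ?_))
      simp only [hexUp] at hu
      omega
    · intro z hz hz₀ hz₁ hzU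
      rw [M_stage_next_of_iff finite_hexUp finite_hexDown,
        ih (by push_cast at hd; omega) (by omega) z hz hz₀
        (fun i => by have := hz₁ i; omega)]
      · intro y
        simp only [hexUp, hexDown]
        omega
      · rintro _ ⟨i, rfl⟩
        exact hzU i

/-- Between the antidiagonals of the two dents. -/
theorem M_stage_between (ha : 1 ≤ a) (hj : 1 ≤ j) (hja : j ≤ a) (hk : 1 ≤ k) (hkc : k ≤ c) (r : ℕ)
    (hd : d + r = a + b + k - 2) (hdj : a + b - j + 1 ≤ d) (y : Fin (b + 1) → ℤ)
    (hy : StrictMono y) (hlo : ∀ i, 0 ≤ y i) (hhi : ∀ i, y i ≤ d - 1) :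
    (M (stage (hexUp a b c j) (hexDown a b c k) d (Set.range y) ∅) : ℤ) =
      Matrix.detRowAlternating fun i => pathsToEnds a b c k d (y i) := by
  induction r generalizing d y with
  | zero =>
    refine M_stage_transfer finite_hexUp finite_hexDown _ (pathsToEnds_rec (by omega) hkc) ?_ ?_
      y hy hlo hhi
    · intro u hu₀ hu₁ hu v i hvi
      refine AlternatingMap.map_coord_zero _ i (hvi.trans (pathsToEnds_eq_zero (by omega) hkc ?_))
      simp only [hexUp] at hu
      omega
    · intro z hz hz₀ hz₁ hzU
      have hzk : ∀ i, (k : ℤ) - 1 ≤ z i := fun i => by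
        have := hzU i
        simp only [hexUp] at this
        omega
      have hzero : ∀ i, i ≠ 0 → z i ≠ k - 1 := fun i hi => by
        have h₁ : z 0 < z i := hz (Fin.pos_of_ne_zero hi)
        have h₂ := hzk 0
        omega
      have hcol : ∀ i, pathsToEnds a b c k (d + 1) (z i) 0 = if z i = k - 1 then 1 else 0 := by
        intro i
        have h₄ : (a + b + k - 1 - (d + 1) : ℤ) = 0 := by omega
        rw [pathsToEnds, h₄, binom_zero_left, Matrix.cons_val_zero]
        congr 1
        rw [eq_iff_iff]
        omega
      have hdet : Matrix.detRowAlternating (fun i => pathsToEnds a b c k (d + 1) (z i)) =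
          if z 0 = k - 1 then
            Matrix.detRowAlternating fun i : Fin b => pathsToSide a b c (d + 1) (z i.succ)
          else 0 := by
        change Matrix.det (Matrix.of fun i => pathsToEnds a b c k (d + 1) (z i)) = _
        rw [Matrix.det_succ_column_zero, Fin.sum_univ_succ]
        have : ∀ i : Fin b, pathsToEnds a b c k (d + 1) (z i.succ) 0 = 0 := fun i => by
          rw [hcol, if_neg (hzero _ (Fin.succ_ne_zero i))]
        simp only [Matrix.of_apply, this, hcol 0]
        split_ifs
        · simp
          rfl
        · simp
      rw [M_stage_next finite_hexUp finite_hexDown, hdet]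
      split_ifs with h₁ h₂ h₂
      · rw [← M_stage_above hj hk hkc (c - k) (by omega) (by omega) (fun i => z i.succ)
          (fun i l hil => hz (Fin.succ_lt_succ_iff.2 hil)) (fun i => hz₀ _)
          (fun i => by have := hz₁ i.succ; omega)]
        congr 3
        ext y
        simp only [Set.mem_ofPred_eq, Set.mem_range]
        constructor
        · rintro ⟨hy₁, hy₂⟩
          obtain ⟨i, rfl⟩ := hy₂ (by simp only [hexUp, hexDown] at hy₁ ⊢; omega)
          refine Fin.cases (fun h => ?_) (fun i _ => ⟨i, rfl⟩) i hy₁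
          simp only [hexDown] at h
          omega
        · rintro ⟨i, rfl⟩
          refine ⟨?_, fun _ => ⟨_, rfl⟩⟩
          have h₃ := hzU i.succ
          have h₄ := hzero i.succ (Fin.succ_ne_zero i)
          simp only [hexUp, hexDown] at h₃ ⊢
          omega
      · have h₃ : hexUp a b c j (d + 1) (k - 1) := by
          simp only [hexUp]
          omega
        have h₄ : (k : ℤ) - 1 ∉ Set.range z := by
          rintro ⟨i, hi⟩
          rcases eq_or_ne i 0 with rfl | hi'
          · exact h₂ hi
          · exact hzero i hi' hi
        have h₅ := h₁ _ h₃ h₄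
        exact absurd ⟨by omega, rfl⟩ h₅.2.2.2.2.2.2
      · refine absurd (fun y hyU hyZ => ?_) h₁
        have : y ≠ k - 1 := fun h => hyZ ⟨0, h₂.trans h.symm⟩
        simp only [hexUp, hexDown] at hyU ⊢
        omega
      · rfl
  | succ r ih =>
    refine M_stage_transfer finite_hexUp finite_hexDown _ (pathsToEnds_rec (by omega) hkc) ?_ ?_
      y hy hlo hhi
    · intro u hu₀ hu₁ hu v i hvi
      refine AlternatingMap.map_coord_zero _ i (hvi.trans (pathsToEnds_eq_zero (by omega) hkc ?_))
      simp only [hexUp] at hu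
      omega
    · intro z hz hz₀ hz₁ hzU
      rw [M_stage_next_of_iff finite_hexUp finite_hexDown,
        ih (by push_cast at hd; omega) (by omega) z hz hz₀
        (fun i => by have := hz₁ i; omega)]
      · intro y
        simp only [hexUp, hexDown]
        omega
      · rintro _ ⟨i, rfl⟩
        exact hzU i

/-- Below both dents; the first row of the determinant belongs to the path that starts at the
dent of the southern side. -/
theorem M_stage_below (ha : 1 ≤ a) (hj : 1 ≤ j) (hja : j ≤ a) (hk : 1 ≤ k) (hkc : k ≤ c) (r : ℕ)
    (hd : d + r = a + b - j) (hdb : b ≤ d) (y : Fin b → ℤ)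
    (hy : StrictMono y) (hlo : ∀ i, 0 ≤ y i) (hhi : ∀ i, y i ≤ d - 1) :
    (M (stage (hexUp a b c j) (hexDown a b c k) d (Set.range y) ∅) : ℤ) =
      Matrix.detRowAlternating.curryLeft (pathsToEnds a b c k (a + b - j + 1) 0)
        fun i => pathsToEnds a b c k d (y i) := by
  induction r generalizing d y with
  | zero =>
    have hds : (a + b - j + 1 : ℤ) = d + 1 := by omega
    refine M_stage_transfer finite_hexUp finite_hexDown _ (pathsToEnds_rec (by omega) hkc) ?_ ?_
      y hy hlo hhi
    · intro u hu₀ hu₁ hu v i hvi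
      rcases eq_or_ne u 0 with rfl | hu'
      · rw [AlternatingMap.curryLeft_apply_apply]
        refine AlternatingMap.map_eq_zero_of_eq _ _ (i := 0) (j := i.succ) ?_
          (Fin.succ_ne_zero i).symm
        simp [hvi, hds]
      · refine AlternatingMap.map_coord_zero _ i
          (hvi.trans (pathsToEnds_eq_zero (by omega) hkc ?_))
        simp only [hexUp] at hu
        omega
    · intro z hz hz₀ hz₁ hzU
      have hpos : ∀ i, 0 < z i := fun i => by
        have := hzU i
        simp only [hexUp] at this
        omega
      rw [AlternatingMap.curryLeft_apply_apply, hds]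
      by_cases hjk : j + k = 2
      · rw [M_stage_next_of_iff finite_hexUp finite_hexDown, M_stage_above hj hk hkc (c - k)
          (by omega) (by omega) z hz hz₀ (fun i => by have := hz₁ i; omega)]
        · change _ = Matrix.det (Matrix.of (Matrix.vecCons (pathsToEnds a b c k (d + 1) 0)
            fun i => pathsToEnds a b c k (d + 1) (z i)))
          have h₄ : (a + b + k - 1 - (d + 1) : ℤ) = 0 := by omega
          have h₅ : ∀ i : Fin b, pathsToEnds a b c k (d + 1) (z i) 0 = 0 := fun i => by
            have := hpos i
            rw [pathsToEnds, h₄, binom_zero_left, Matrix.cons_val_zero, if_neg (by omega)]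
          have h₆ : pathsToEnds a b c k (d + 1) 0 0 = 1 := by
            rw [pathsToEnds, h₄, binom_zero_left, Matrix.cons_val_zero, if_pos (by omega)]
          rw [Matrix.det_succ_column_zero, Fin.sum_univ_succ]
          simp [h₅, h₆]
          rfl
        · intro y
          simp only [hexUp, hexDown]
          omega
        · rintro _ ⟨i, rfl⟩
          exact hzU i
      · have hcons : (Matrix.vecCons (pathsToEnds a b c k (d + 1) 0)
            fun i => pathsToEnds a b c k (d + 1) (z i)) =
            fun i => pathsToEnds a b c k (d + 1) (Matrix.vecCons 0 z i) := by
          funext i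
          refine Fin.cases ?_ (fun i => ?_) i <;> simp
        rw [hcons, ← M_stage_between ha hj hja hk hkc (j + k - 3) (by omega) (by omega)
          (Matrix.vecCons 0 z), M_stage_next finite_hexUp finite_hexDown, if_pos]
        · congr 3
          ext y
          simp only [Set.mem_ofPred_eq, Matrix.range_cons, Set.mem_union, Set.mem_singleton_iff]
          constructor
          · rintro ⟨h₁, h₂⟩
            by_cases h₃ : y = 0
            · exact Or.inl h₃
            · refine Or.inr (h₂ ?_)
              simp only [hexUp, hexDown] at h₁ ⊢
              omega
          · rintro (rfl | ⟨i, rfl⟩)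
            · refine ⟨?_, fun h => absurd ⟨by omega, rfl⟩ h.2.2.2.2.2.2⟩
              simp only [hexDown]
              omega
            · refine ⟨?_, fun _ => ⟨i, rfl⟩⟩
              have h₁ := hzU i
              simp only [hexUp, hexDown] at h₁ ⊢
              omega
        · intro y hyU _
          simp only [hexUp, hexDown] at hyU ⊢
          omega
        · intro i l
          refine Fin.cases ?_ (fun i => ?_) i <;> refine Fin.cases ?_ (fun l => ?_) l
          · simp
          · simpa using hpos l
          · simp
          · simpa using fun h => hz h
        · intro i
          refine Fin.cases ?_ (fun i => ?_) i
          · simp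
          · simpa using hz₀ i
        · intro i
          refine Fin.cases ?_ (fun i => ?_) i
          · simp only [Matrix.cons_val_zero]
            omega
          · have := hz₁ i
            simp only [Matrix.cons_val_succ]
            omega
  | succ r ih =>
    refine M_stage_transfer finite_hexUp finite_hexDown _ (pathsToEnds_rec (by omega) hkc) ?_ ?_
      y hy hlo hhi
    · intro u hu₀ hu₁ hu v i hvi
      refine AlternatingMap.map_coord_zero _ i (hvi.trans (pathsToEnds_eq_zero (by omega) hkc ?_))
      simp only [hexUp] at hu
      omega
    · intro z hz hz₀ hz₁ hzU
      rw [M_stage_next_of_iff finite_hexUp finite_hexDown,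
        ih (by push_cast at hd; omega) (by omega) z hz hz₀
        (fun i => by have := hz₁ i; omega)]
      · intro y
        simp only [hexUp, hexDown]
        omega
      · rintro _ ⟨i, rfl⟩
        exact hzU i

theorem dented_hex_eq_stage (ha : 1 ≤ a) :
    Hex a b c \ {((a : ℤ) + b - j, 0, true), ((a : ℤ) + b - 1, (k : ℤ) - 1, false)} =
      stage (hexUp a b c j) (hexDown a b c k) b (Set.range fun i : Fin b => (i.val : ℤ)) ∅ := by
  have hrange : ∀ w : ℤ, (w ∈ Set.range fun i : Fin b => (i.val : ℤ)) ↔ 0 ≤ w ∧ w < b := by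
    intro w
    constructor
    · rintro ⟨i, rfl⟩
      have := i.2
      simp only
      omega
    · rintro ⟨h₁, h₂⟩
      exact ⟨⟨w.toNat, by omega⟩, by simp only; omega⟩
  refine ext_tri (fun e w => ?_) fun e w => ?_
  · rw [upTri_mem_stage]
    simp [Hex, HexK, hexUp]
    omega
  · rw [downTri_mem_stage, hrange]
    simp [Hex, HexK, hexDown]
    omega

/-- The number of tilings of the dented hexagon as a determinant of path numbers. -/
theorem ADJ_eq_det (ha : 1 ≤ a) (hj : 1 ≤ j) (hja : j ≤ a) (hk : 1 ≤ k) (hkc : k ≤ c) :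
    (ADJ a b c j k : ℤ) = Matrix.det (Matrix.of (Matrix.vecCons
      (pathsToEnds a b c k (a + b - j + 1) 0) fun i : Fin b => pathsToEnds a b c k b i)) := by
  rw [ADJ, dented_hex_eq_stage ha, M_stage_below ha hj hja hk hkc (a - j) (by omega) le_rfl
    _ _ (fun i => by omega) (fun i => by have := i.2; omega)]
  · rfl
  · intro i l hil
    simpa using hil

end Hexagon

section Condensation

open Polynomial

variable {m : Type*} [Fintype m] [DecidableEq m]

theorem Matrix.det_mul_det_toBlocks₁₁_of_ne_zero {K : Type*} [Field K]
    (N : Matrix (m ⊕ Fin 2) (m ⊕ Fin 2) K) (h : N.toBlocks₁₁.det ≠ 0) :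
    N.det * N.toBlocks₁₁.det =
      (N.submatrix (Sum.map id fun _ : Unit => 0) (Sum.map id fun _ : Unit => 0)).det *
          (N.submatrix (Sum.map id fun _ : Unit => 1) (Sum.map id fun _ : Unit => 1)).det -
        (N.submatrix (Sum.map id fun _ : Unit => 0) (Sum.map id fun _ : Unit => 1)).det *
          (N.submatrix (Sum.map id fun _ : Unit => 1) (Sum.map id fun _ : Unit => 0)).det := by
  have : Invertible N.toBlocks₁₁ := Matrix.invertibleOfIsUnitDet _ h.isUnit
  have hminor : ∀ p q : Fin 2,
      (N.submatrix (Sum.map id fun _ : Unit => p) (Sum.map id fun _ : Unit => q)).det =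
        N.toBlocks₁₁.det *
          (N.toBlocks₂₂ - N.toBlocks₂₁ * ⅟N.toBlocks₁₁ * N.toBlocks₁₂) p q := by
    intro p q
    have hblocks : N.submatrix (Sum.map id fun _ : Unit => p) (Sum.map id fun _ : Unit => q) =
        Matrix.fromBlocks N.toBlocks₁₁ (N.toBlocks₁₂.submatrix id fun _ : Unit => q)
          (N.toBlocks₂₁.submatrix (fun _ : Unit => p) id)
          (N.toBlocks₂₂.submatrix (fun _ => p) fun _ => q) := by
      ext (x | x) (y | y) <;> rfl
    rw [hblocks, Matrix.det_fromBlocks₁₁, Matrix.det_unique (n := Unit)]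
    simp only [Matrix.sub_apply, Matrix.mul_apply, Matrix.submatrix_apply, id]
  have hN : N.det = N.toBlocks₁₁.det *
      (N.toBlocks₂₂ - N.toBlocks₂₁ * ⅟N.toBlocks₁₁ * N.toBlocks₁₂).det := by
    conv_lhs => rw [← Matrix.fromBlocks_toBlocks N]
    exact Matrix.det_fromBlocks₁₁ _ _ _ _
  rw [hN, hminor, hminor, hminor, hminor, Matrix.det_fin_two]
  ring

/-- The Desnanot–Jacobi identity for a matrix in block form. -/
theorem Matrix.det_mul_det_toBlocks₁₁ {R : Type*} [CommRing R] [IsDomain R]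
    (N : Matrix (m ⊕ Fin 2) (m ⊕ Fin 2) R) :
    N.det * N.toBlocks₁₁.det =
      (N.submatrix (Sum.map id fun _ : Unit => 0) (Sum.map id fun _ : Unit => 0)).det *
          (N.submatrix (Sum.map id fun _ : Unit => 1) (Sum.map id fun _ : Unit => 1)).det -
        (N.submatrix (Sum.map id fun _ : Unit => 0) (Sum.map id fun _ : Unit => 1)).det *
          (N.submatrix (Sum.map id fun _ : Unit => 1) (Sum.map id fun _ : Unit => 0)).det := by
  let P : Matrix (m ⊕ Fin 2) (m ⊕ Fin 2) R[X] :=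
    Matrix.fromBlocks ((X : R[X]) • 1 + N.toBlocks₁₁.map C) (N.toBlocks₁₂.map C)
      (N.toBlocks₂₁.map C) (N.toBlocks₂₂.map C)
  let φ : R[X] →+* FractionRing R[X] := algebraMap _ _
  have hφ : Function.Injective φ := IsFractionRing.injective _ _
  have hdet : P.toBlocks₁₁.det ≠ 0 := by
    rw [Matrix.toBlocks_fromBlocks₁₁]
    intro h
    have := leadingCoeff_det_X_one_add_C N.toBlocks₁₁
    rw [h] at this
    simp at this
  have hP := Matrix.det_mul_det_toBlocks₁₁_of_ne_zero (P.map φ) fun h =>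
    hdet (hφ (by rw [RingHom.map_det, map_zero]; exact h))
  have hP' : _ = _ - _ := hφ (a₁ := P.det * P.toBlocks₁₁.det)
    (a₂ := (P.submatrix (Sum.map id fun _ : Unit => 0) (Sum.map id fun _ : Unit => 0)).det *
          (P.submatrix (Sum.map id fun _ : Unit => 1) (Sum.map id fun _ : Unit => 1)).det -
        (P.submatrix (Sum.map id fun _ : Unit => 0) (Sum.map id fun _ : Unit => 1)).det *
          (P.submatrix (Sum.map id fun _ : Unit => 1) (Sum.map id fun _ : Unit => 0)).det)
    (by simp only [map_mul, map_sub, RingHom.map_det]; exact hP)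
  have hN : P.map (evalRingHom 0) = N := by
    ext (x | x) (y | y) <;>
      simp [P, Matrix.one_apply, apply_ite (eval (0 : R)), Matrix.toBlocks₁₁,
        Matrix.toBlocks₁₂, Matrix.toBlocks₂₁, Matrix.toBlocks₂₂]
  have hev := congrArg (evalRingHom (0 : R)) hP'
  simp only [map_mul, map_sub, RingHom.map_det] at hev
  rw [← hN]
  exact hev

theorem Matrix.det_submatrix_mul_det_submatrix {R n l : Type*} [CommRing R] [Fintype n]
    [DecidableEq n] [Fintype l] [DecidableEq l] (A B : Matrix n n R) (e f : l ≃ n) :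
    (A.submatrix e f).det * (B.submatrix f e).det = A.det * B.det := by
  have h : ∀ (A : Matrix n n R) (e f : l ≃ n),
      (A.submatrix e f).det = Equiv.Perm.sign (e.symm.trans f) * A.det := fun A e f => by
    rw [← Matrix.det_permute', ← Matrix.det_submatrix_equiv_self e]
    congr 1
    ext
    simp
  have hef : f.symm.trans e = (e.symm.trans f)⁻¹ := rfl
  rw [h, h, hef, Equiv.Perm.sign_inv, mul_mul_mul_comm, ← Int.cast_mul, ← Units.val_mul,
    Int.units_mul_self, Units.val_one, Int.cast_one, one_mul]

/-- The Desnanot–Jacobi identity for the last and one more row and column. -/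
theorem Matrix.det_mul_det_submatrix_succAbove {R : Type*} [CommRing R] [IsDomain R] {n : ℕ}
    (N : Matrix (Fin (n + 2)) (Fin (n + 2)) R) (p : Fin (n + 1)) :
    N.det * (N.submatrix (fun i => (p.succAbove i).castSucc)
        fun i => (p.succAbove i).castSucc).det =
      (N.submatrix Fin.castSucc Fin.castSucc).det *
          (N.submatrix p.castSucc.succAbove p.castSucc.succAbove).det -
        (N.submatrix Fin.castSucc p.castSucc.succAbove).det *
          (N.submatrix p.castSucc.succAbove Fin.castSucc).det := by
  let e₀ : Fin n ⊕ Unit ≃ Fin (n + 1) :=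
    (Equiv.optionEquivSumPUnit _).symm.trans (finSuccEquiv' p).symm
  let e₁ : Fin n ⊕ Unit ≃ Fin (n + 1) :=
    (Equiv.optionEquivSumPUnit _).symm.trans (finSuccEquiv' (Fin.last n)).symm
  let e : Fin n ⊕ Fin 2 ≃ Fin (n + 2) := Equiv.ofBijective
    (Sum.elim (fun i => (p.succAbove i).castSucc) ![p.castSucc, Fin.last _]) <| by
      refine (Fintype.bijective_iff_injective_and_card _).2 ⟨?_, by simp⟩
      refine Function.Injective.sumElim
        ((Fin.castSucc_injective _).comp Fin.succAbove_right_injective) ?_ ?_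
      · intro x y h
        fin_cases x <;> fin_cases y <;>
          simp_all [Fin.castSucc_ne_last, (Fin.castSucc_ne_last _).symm]
      · intro x y
        fin_cases y <;> simp [Fin.castSucc_ne_last, Fin.succAbove_ne]
  have h₀ : ∀ x, e (Sum.map id (fun _ : Unit => 0) x) = (e₀ x).castSucc := by
    rintro (x | x) <;> simp [e, e₀]
  have h₁ : ∀ x, e (Sum.map id (fun _ : Unit => 1) x) = p.castSucc.succAbove (e₁ x) := by
    rintro (x | x) <;> simp [e, e₁]
  have h := Matrix.det_mul_det_toBlocks₁₁ (N.submatrix e e)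
  simp only [Matrix.submatrix_submatrix, Function.comp_def, h₀, h₁] at h
  have hmixed := Matrix.det_submatrix_mul_det_submatrix
    (N.submatrix Fin.castSucc p.castSucc.succAbove)
    (N.submatrix p.castSucc.succAbove Fin.castSucc) e₀ e₁
  rw [← hmixed, ← Matrix.det_submatrix_equiv_self e N,
    ← Matrix.det_submatrix_equiv_self e₀ (N.submatrix Fin.castSucc Fin.castSucc),
    ← Matrix.det_submatrix_equiv_self e₁]
  exact h

end Condensation

/-- The numbers of lattice paths joining the starting points, the dent of the southern side
coming first, to the end points, the dent of the southeastern side coming first. -/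
def pathMatrix (a c j k : ℕ) (i l : ℕ) : ℤ :=
  if i = 0 then if l = 0 then binom (j + k - 2) (k - 1) else binom (c + j - 1) (c + l - 1)
  else if l = 0 then binom (a + k - 1) (k - i) else binom (a + c) (c + l - i)

/-- Add to each term of a sequence, from the term of index two onwards, the preceding term. -/
def addPred (f : ℕ → ℤ) (i : ℕ) : ℤ := if i ≤ 1 then f i else f (i - 1) + f i

theorem addPred_comm (f : ℕ → ℕ → ℤ) (i l : ℕ) :
    addPred (fun i => addPred (f i) l) i = addPred (fun l => addPred (fun i => f i l) i) l := by
  unfold addPred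
  split_ifs <;> ring

theorem det_addPred_row {n : ℕ} (G : ℕ → Fin (n + 1) → ℤ) :
    (Matrix.of fun i l : Fin (n + 1) => addPred (fun i => G i l) i).det =
      (Matrix.of fun i l : Fin (n + 1) => G i l).det := by
  refine (Matrix.det_eq_of_forall_row_eq_smul_add_pred
    (fun i => if (i : ℕ) = 0 then 0 else -1) (fun l => ?_) fun i l => ?_).symm
  · simp [addPred]
  · simp only [Matrix.of_apply, addPred, Fin.val_succ, Fin.val_castSucc]
    split_ifs <;> first | omega | simp

theorem det_addPred_col {n : ℕ} (G : Fin (n + 1) → ℕ → ℤ) :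
    (Matrix.of fun i l : Fin (n + 1) => addPred (G i) l).det =
      (Matrix.of fun i l : Fin (n + 1) => G i l).det := by
  rw [← Matrix.det_transpose, ← Matrix.det_transpose (Matrix.of fun i l : Fin (n + 1) => G i l)]
  exact det_addPred_row fun l i => G i l

/-- Omit the index one. -/
def skipOne (i : ℕ) : ℕ := if i = 0 then 0 else i + 1

theorem Fin.val_one_succAbove {n : ℕ} (i : Fin (n + 1)) :
    ((1 : Fin (n + 2)).succAbove i : ℕ) = skipOne i := by
  refine Fin.cases ?_ (fun i => ?_) i
  · simp [skipOne]
  · rw [Fin.one_succAbove_succ]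
    simp [skipOne]

section PathMatrix

variable {a c j k : ℕ}

theorem addPred_pathMatrix_col (hj : 1 ≤ j) (i l : ℕ) :
    addPred (pathMatrix a c j k i) (skipOne l) = pathMatrix a (c + 1) j k i l := by
  rcases l with _ | l
  · simp [addPred, skipOne, pathMatrix]
  · simp only [addPred, skipOne, pathMatrix, Nat.succ_ne_zero, if_false, Nat.add_sub_cancel]
    rw [if_neg (by omega)]
    split_ifs
    · rw [show ((c + 1 : ℕ) + j - 1 : ℤ) = c + j - 1 + 1 by push_cast; ring,
        binom_add_one (by omega), add_comm]
      congr 2 <;> push_cast <;> ring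
    · rw [show (a + (c + 1 : ℕ) : ℤ) = a + c + 1 by push_cast; ring,
        binom_add_one (by omega), add_comm]
      congr 2 <;> push_cast <;> ring

theorem addPred_pathMatrix_row (hk : 1 ≤ k) (i l : ℕ) :
    addPred (fun i => pathMatrix a c j k i l) (skipOne i) = pathMatrix (a + 1) c j k i l := by
  rcases i with _ | i
  · simp [addPred, skipOne, pathMatrix]
  · simp only [addPred, skipOne, pathMatrix, Nat.succ_ne_zero, if_false, Nat.add_sub_cancel]
    rw [if_neg (by omega)]
    split_ifs
    · rw [show ((a + 1 : ℕ) + k - 1 : ℤ) = a + k - 1 + 1 by push_cast; ring,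
        binom_add_one (by omega)]
      congr 2
      push_cast
      ring
    · rw [show ((a + 1 : ℕ) + c : ℤ) = a + c + 1 by push_cast; ring, binom_add_one (by omega)]
      congr 2
      push_cast
      ring

theorem ADJ_eq_det_pathMatrix {b : ℕ} (ha : 1 ≤ a) (hj : 1 ≤ j) (hja : j ≤ a) (hk : 1 ≤ k)
    (hkc : k ≤ c) : (ADJ a b c j k : ℤ) =
      (Matrix.of fun i l : Fin (b + 1) => pathMatrix a c j k i l).det := by
  rw [ADJ_eq_det ha hj hja hk hkc]
  congr 1
  ext i l
  refine Fin.cases ?_ (fun i => ?_) i <;> refine Fin.cases ?_ (fun l => ?_) l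
  · simp [pathMatrix, pathsToEnds]
    congr 1
    ring
  · simp [pathMatrix, pathsToEnds, pathsToSide]
    congr 1 <;> ring
  · simp [pathMatrix, pathsToEnds]
    congr 1 <;> ring
  · simp [pathMatrix, pathsToEnds, pathsToSide]
    congr 1 <;> ring

theorem ADJ_condensation {b : ℕ} (ha : 1 ≤ a) (hj : 1 ≤ j) (hja : j ≤ a) (hk : 1 ≤ k)
    (hkc : k ≤ c) :
    (ADJ a (b + 2) c j k * ADJ (a + 1) b (c + 1) j k : ℤ) =
      ADJ a (b + 1) c j k * ADJ (a + 1) (b + 1) (c + 1) j k -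
        ADJ a (b + 1) (c + 1) j k * ADJ (a + 1) (b + 1) c j k := by
  let B : ℕ → ℕ → ℤ := fun i l => addPred (fun i => addPred (pathMatrix a c j k i) l) i
  have hB : ∀ n, (Matrix.of fun i l : Fin (n + 1) => B i l).det =
      (Matrix.of fun i l : Fin (n + 1) => pathMatrix a c j k i l).det := fun n =>
    (det_addPred_row fun i l => addPred (pathMatrix a c j k i) l).trans
      (det_addPred_col fun i l => pathMatrix a c j k i l)
  have hB₁ : ∀ i l, B i (skipOne l) = addPred (fun i => pathMatrix a (c + 1) j k i l) i :=
    fun i l => by simp only [B, addPred_pathMatrix_col hj]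
  have hB₂ : ∀ i l, B (skipOne i) l = addPred (pathMatrix (a + 1) c j k i) l := fun i l => by
    simp only [B]
    rw [addPred_comm]
    simp only [addPred_pathMatrix_row hk]
  have hB₃ : ∀ i l, B (skipOne i) (skipOne l) = pathMatrix (a + 1) (c + 1) j k i l :=
    fun i l => by rw [hB₁, addPred_pathMatrix_row hk]
  rw [ADJ_eq_det_pathMatrix ha hj hja hk hkc, ADJ_eq_det_pathMatrix ha hj hja hk hkc,
    ADJ_eq_det_pathMatrix ha hj hja hk (by omega),
    ADJ_eq_det_pathMatrix (by omega) hj (by omega) hk hkc,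
    ADJ_eq_det_pathMatrix (by omega) hj (by omega) hk (by omega),
    ADJ_eq_det_pathMatrix (by omega) hj (by omega) hk (by omega), ← hB, ← hB,
    ← det_addPred_row fun i (l : Fin (b + 2)) => pathMatrix a (c + 1) j k i l,
    ← det_addPred_col fun (i : Fin (b + 2)) l => pathMatrix (a + 1) c j k i l]
  have h := Matrix.det_mul_det_submatrix_succAbove
    (Matrix.of fun i l : Fin (b + 3) => B i l) (1 : Fin (b + 2))
  simp only [Matrix.submatrix, Matrix.of_apply, Fin.castSucc_one, Fin.val_castSucc,
    Fin.val_one_succAbove, hB₃] at h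
  simp only [hB₁, hB₂] at h
  exact h

end PathMatrix

/-- Kuo's condensation recurrence for `ADJ(a,b,c)_{j,k}`. -/
theorem adj_recurrence (a b c j k : ℕ) (ha : 2 ≤ a) (hb : 1 ≤ b) (hc : 2 ≤ c)
    (hj1 : 1 ≤ j) (hj2 : j ≤ a - 1) (hk1 : 1 ≤ k) (hk2 : k ≤ c - 1) :
    ADJ a b c j k * ADJ (a - 1) b (c - 1) j k =
      ADJ a b (c - 1) j k * ADJ (a - 1) b c j k +
        ADJ (a - 1) (b + 1) (c - 1) j k * ADJ a (b - 1) c j k := by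
  obtain ⟨a, rfl⟩ : ∃ a', a = a' + 1 := ⟨a - 1, by omega⟩
  obtain ⟨b, rfl⟩ : ∃ b', b = b' + 1 := ⟨b - 1, by omega⟩
  obtain ⟨c, rfl⟩ : ∃ c', c = c' + 1 := ⟨c - 1, by omega⟩
  simp only [Nat.add_sub_cancel] at hj2 hk2 ⊢
  have h := ADJ_condensation (b := b) (by omega) hj1 hj2 hk1 hk2
  zify
  linarith
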